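/- Let μ be symmetric (invariant under x ↦ −x) and take c = 0 with masses M_0, …, M_{2r+1} ≥ 0 in the Sobolev inner product. Then there exist two families of real coefficients (λ_{j,n})_{j=0}^{r+1} and (λ*_{j,n})_{j=0}^{r+1}, each not identically zero, such that for all n ≥ r+1: q_{2n}(x) = Σ_{j=0}^{r+1} λ_{j,n} x^{2j} p_{2n−2j}^{[4j]}(x) and q_{2n+1}(x) = Σ_{j=0}^{r+1} λ*_{j,n} x^{2j} p_{2n+1−2j}^{[4j]}(x). -/

import Mathlib

open MeasureTheory Polynomial Filter Topology

noncomputable section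

/-- The support of a Borel measure on `ℝ`. -/
def measSupport (μ : Measure ℝ) : Set ℝ := {x | ∀ U ∈ nhds x, μ U ≠ 0}

/-- `P` is a sequence of orthonormal polynomials with respect to the measure `μ`. -/
def IsOPS (μ : Measure ℝ) (P : ℕ → Polynomial ℝ) : Prop :=
  (∀ n, (P n).degree = n) ∧ (∀ n, 0 < (P n).leadingCoeff) ∧
    ∀ n m, (∫ x, (P n).eval x * (P m).eval x ∂μ) = if n = m then 1 else 0

/-- The modified measure `dμ_j(x) = x^j dμ(x)` (that is, `(x-c)^j dμ` with `c = 0`). -/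
def muMod (μ : Measure ℝ) (c : ℝ) (j : ℕ) : Measure ℝ :=
  μ.withDensity fun x => ENNReal.ofReal ((x - c) ^ j)

/-- The discrete Sobolev inner product. -/
def sobInner (μ : Measure ℝ) (c : ℝ) (r : ℕ) (M : ℕ → ℝ) (p q : Polynomial ℝ) : ℝ :=
  (∫ x, p.eval x * q.eval x ∂μ) +
    ∑ i ∈ Finset.range (r + 1),
      M i * (Polynomial.derivative^[i] p).eval c * (Polynomial.derivative^[i] q).eval c

/-- `Q` is the sequence of orthonormal polynomials for the Sobolev inner product. -/
def IsSobOPS (μ : Measure ℝ) (c : ℝ) (r : ℕ) (M : ℕ → ℝ) (Q : ℕ → Polynomial ℝ) : Prop :=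
  (∀ n, (Q n).degree = n) ∧ (∀ n, 0 < (Q n).leadingCoeff) ∧
    ∀ n m, sobInner μ c r M (Q n) (Q m) = if n = m then 1 else 0

section OrthonormalSequences

/-- `Q` is a sequence of polynomials of degree `n`, orthonormal for the bilinear form `B`. -/
structure IsOrthonormalFor (B : LinearMap.BilinForm ℝ ℝ[X]) (Q : ℕ → ℝ[X]) : Prop where
  symm : ∀ f g, B f g = B g f
  degree : ∀ n, (Q n).degree = n
  inner : ∀ n m, B (Q n) (Q m) = if n = m then 1 else 0

namespace IsOrthonormalFor

variable {B : LinearMap.BilinForm ℝ ℝ[X]} {Q : ℕ → ℝ[X]}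

lemma ne_zero (h : IsOrthonormalFor B Q) (n : ℕ) : Q n ≠ 0 := by
  intro h0
  simpa [h0] using h.degree n

lemma coeff_ne_zero (h : IsOrthonormalFor B Q) (n : ℕ) : (Q n).coeff n ≠ 0 :=
  Polynomial.coeff_ne_zero_of_eq_degree (h.degree n)

lemma degree_le_of_degree_lt_succ {f : ℝ[X]} {n : ℕ} (hf : f.degree < (n + 1 : ℕ)) :
    f.degree ≤ n := by
  rw [degree_le_iff_coeff_zero]
  exact fun i hi => (degree_lt_iff_coeff_zero _ _).mp hf i (by exact_mod_cast hi)

lemma exists_eq_add (h : IsOrthonormalFor B Q) {f : ℝ[X]} {n : ℕ} (hf : f.degree ≤ n) :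
    ∃ a : ℝ, ∃ g : ℝ[X], g.degree < n ∧ f = C a * Q n + g := by
  have hq := h.coeff_ne_zero n
  refine ⟨f.coeff n / (Q n).coeff n, f - C (f.coeff n / (Q n).coeff n) * Q n, ?_, by ring⟩
  rw [degree_lt_iff_coeff_zero]
  intro m hm
  rcases hm.eq_or_lt with rfl | hm
  · simp [hq]
  · have h1 : f.coeff m = 0 :=
      coeff_eq_zero_of_degree_lt (hf.trans_lt (by exact_mod_cast hm))
    have h2 : (Q n).coeff m = 0 :=
      coeff_eq_zero_of_degree_lt ((h.degree n).trans_lt (by exact_mod_cast hm))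
    simp [h1, h2]

lemma apply_C_mul (B : LinearMap.BilinForm ℝ ℝ[X]) (a : ℝ) (f g : ℝ[X]) :
    B (C a * f) g = a * B f g := by
  rw [← smul_eq_C_mul]; simp

lemma apply_eq_zero_of_degree_lt (h : IsOrthonormalFor B Q) (n : ℕ) {m : ℕ} (hm : m ≤ n) :
    ∀ f : ℝ[X], f.degree < m → B f (Q n) = 0 := by
  induction m with
  | zero =>
    intro f hf
    have : f = 0 := by simpa using hf
    simp [this]
  | succ m ih =>
    intro f hf
    have hf' : f.degree ≤ m := degree_le_of_degree_lt_succ hf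
    obtain ⟨a, g, hg, rfl⟩ := h.exists_eq_add hf'
    rw [map_add, LinearMap.add_apply, apply_C_mul, h.inner, ih (by omega) g hg,
      if_neg (by omega)]
    simp

lemma eq_zero_of_apply_self (h : IsOrthonormalFor B Q) {f : ℝ[X]} (hf : B f f = 0) : f = 0 := by
  have key : ∀ m : ℕ, ∀ f : ℝ[X], f.degree < m → 0 ≤ B f f ∧ (B f f = 0 → f = 0) := by
    intro m
    induction m with
    | zero =>
      intro f hf
      have : f = 0 := by simpa using hf
      simp [this]
    | succ m ih =>
      intro f hf
      have hf' : f.degree ≤ m := degree_le_of_degree_lt_succ hf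
      obtain ⟨a, g, hg, rfl⟩ := h.exists_eq_add hf'
      have h0 := h.apply_eq_zero_of_degree_lt m le_rfl g hg
      have e : B (C a * Q m + g) (C a * Q m + g) = a ^ 2 + B g g := by
        rw [map_add B, LinearMap.add_apply, map_add, map_add, apply_C_mul, apply_C_mul,
          h.symm (Q m) (C a * Q m), h.symm g (C a * Q m), apply_C_mul, apply_C_mul, h.inner,
          h.symm (Q m) g, h0]
        simp; ring
      obtain ⟨h1, h2⟩ := ih g hg
      rw [e]
      refine ⟨by positivity, fun h3 => ?_⟩
      have ha : a = 0 := by nlinarith [sq_nonneg a]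
      have hg0 : g = 0 := h2 (by nlinarith [sq_nonneg a])
      simp [ha, hg0]
  refine (key (f.natDegree + 1) f ?_).2 hf
  exact degree_le_natDegree.trans_lt (by exact_mod_cast Nat.lt_succ_self _)

lemma exists_eq_C_mul (h : IsOrthonormalFor B Q) {f : ℝ[X]} {n : ℕ} (hf : f.degree ≤ n)
    (horth : ∀ g : ℝ[X], g.degree < n → B f g = 0) : ∃ a : ℝ, f = C a * Q n := by
  obtain ⟨a, g, hg, rfl⟩ := h.exists_eq_add hf
  refine ⟨a, ?_⟩
  have h1 := horth g hg
  rw [map_add, LinearMap.add_apply, apply_C_mul, h.symm (Q n) g,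
    h.apply_eq_zero_of_degree_lt n le_rfl g hg, mul_zero, zero_add] at h1
  rw [h.eq_zero_of_apply_self h1, add_zero]

lemma coeff_comp_neg_X (f : ℝ[X]) (i : ℕ) : (f.comp (-X)).coeff i = (-1) ^ i * f.coeff i := by
  rw [show (-X : ℝ[X]) = C (-1) * X by simp, comp_C_mul_X_coeff, mul_comm]

lemma coeff_eq_zero_of_odd_add (h : IsOrthonormalFor B Q)
    (hB : ∀ f g, B (f.comp (-X)) (g.comp (-X)) = B f g) {n i : ℕ} (hi : Odd (i + n)) :
    (Q n).coeff i = 0 := by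
  obtain ⟨a, ha⟩ : ∃ a : ℝ, (Q n).comp (-X) = C a * Q n := by
    refine h.exists_eq_C_mul (degree_comp_neg_X.trans (h.degree n)).le fun g hg => ?_
    have := hB (Q n) (g.comp (-X))
    rw [show (g.comp (-X)).comp (-X) = g by simp [comp_assoc]] at this
    rw [this, h.symm]
    exact h.apply_eq_zero_of_degree_lt n le_rfl _ (by rwa [degree_comp_neg_X])
  have hn := congrArg (fun f => coeff f n) ha
  have hi' := congrArg (fun f => coeff f i) ha
  simp only [coeff_comp_neg_X, coeff_C_mul] at hn hi'
  have han : a = (-1) ^ n := (mul_right_cancel₀ (h.coeff_ne_zero n) hn).symm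
  rw [han] at hi'
  have hs : (-1 : ℝ) ^ i = - (-1) ^ n := by
    have h1 := hi.neg_one_pow (α := ℝ)
    rw [pow_add] at h1
    rcases neg_one_pow_eq_or ℝ i with h2 | h2 <;> rcases neg_one_pow_eq_or ℝ n with h3 | h3 <;>
      rw [h2, h3] at h1 <;> rw [h2, h3] <;> linarith
  rw [hs] at hi'
  rcases neg_one_pow_eq_or ℝ n with h3 | h3 <;> rw [h3] at hi' <;> linarith

/-- If multiplication by `X` is symmetric for `B`, the lowest coefficient of `Q n` allowed by
parity does not vanish. -/
lemma coeff_mod_two_ne_zero (h : IsOrthonormalFor B Q)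
    (hB : ∀ f g, B (f.comp (-X)) (g.comp (-X)) = B f g)
    (hX : ∀ f g, B (X * f) g = B f (X * g)) (n : ℕ) : (Q n).coeff (n % 2) ≠ 0 := by
  intro h0
  have hdvd : X ^ (n % 2 + 2) ∣ Q n := by
    rw [X_pow_dvd_iff]
    intro d hd
    by_cases hdn : d = n % 2
    · rw [hdn, h0]
    · apply h.coeff_eq_zero_of_odd_add hB
      rw [Nat.odd_iff]
      omega
  obtain ⟨s, hs⟩ := hdvd
  have hs0 : X ^ (n % 2) * s ≠ 0 := by
    intro hz
    apply h.ne_zero n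
    rw [hs, pow_add, mul_right_comm, hz, zero_mul]
  have hdeg : (X ^ (n % 2) * s).degree < (n : WithBot ℕ) := by
    have h1 : Q n = X ^ 2 * (X ^ (n % 2) * s) := by rw [hs]; ring
    have h2 := h.degree n
    rw [h1, degree_mul, degree_X_pow, degree_eq_natDegree hs0] at h2
    rw [degree_eq_natDegree hs0]
    norm_cast at h2 ⊢
    omega
  have h3 := h.apply_eq_zero_of_degree_lt n le_rfl _ hdeg
  rw [show Q n = X * (X * (X ^ (n % 2) * s)) by rw [hs]; ring, ← hX] at h3
  have h4 := h.eq_zero_of_apply_self h3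
  exact hs0 ((mul_eq_zero.mp h4).resolve_left X_ne_zero)

end IsOrthonormalFor

end OrthonormalSequences

section Elimination

/-- The bilinear form `(f, g) ↦ L (X ^ m * f * g)` attached to a linear functional `L`. -/
def weightedForm (L : ℝ[X] →ₗ[ℝ] ℝ) (m : ℕ) : LinearMap.BilinForm ℝ ℝ[X] :=
  LinearMap.mk₂ ℝ (fun f g => L (X ^ m * (f * g)))
    (fun f f' g => by rw [add_mul, mul_add, map_add])
    (fun a f g => by rw [smul_mul_assoc, mul_smul_comm, map_smul])
    (fun f g g' => by rw [mul_add, mul_add, map_add])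
    (fun a f g => by rw [mul_smul_comm, mul_smul_comm, map_smul])

lemma weightedForm_apply (L : ℝ[X] →ₗ[ℝ] ℝ) (m : ℕ) (f g : ℝ[X]) :
    weightedForm L m f g = L (X ^ m * (f * g)) := rfl

lemma weightedForm_X_mul (L : ℝ[X] →ₗ[ℝ] ℝ) (m : ℕ) (f g : ℝ[X]) :
    weightedForm L m (X * f) g = weightedForm L m f (X * g) := by
  rw [weightedForm_apply, weightedForm_apply]
  congr 1
  ring

lemma weightedForm_comp_neg_X {L : ℝ[X] →ₗ[ℝ] ℝ} (hL : ∀ f, L (f.comp (-X)) = L f) {m : ℕ}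
    (hm : Even m) (f g : ℝ[X]) :
    weightedForm L m (f.comp (-X)) (g.comp (-X)) = weightedForm L m f g := by
  rw [weightedForm_apply, weightedForm_apply, ← hL (X ^ m * (f * g))]
  simp [hm.neg_pow]

/-- Expansion of a polynomial of definite parity, orthogonal to `X ^ (2 * k) * h` for all `h` of
low degree, in terms of the polynomials `X ^ (2 * j) * P j (N - 2 * j)`. -/
lemma exists_connection_coefficients {L : ℝ[X] →ₗ[ℝ] ℝ} (hL : ∀ f, L (f.comp (-X)) = L f)
    {k N : ℕ} (hN : 2 * k ≤ N) {P : ℕ → ℕ → ℝ[X]}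
    (hP : ∀ j ≤ k, IsOrthonormalFor (weightedForm L (4 * j)) (P j))
    {Q : ℝ[X]} (hdeg : Q.degree ≤ N) (hpar : ∀ i, Odd (i + N) → Q.coeff i = 0)
    (horth : ∀ h : ℝ[X], h.degree < (N - 2 * k : ℕ) → L (Q * (X ^ (2 * k) * h)) = 0) :
    ∃ a : ℕ → ℝ, Q = ∑ j ∈ Finset.range (k + 1), C (a j) * X ^ (2 * j) * P j (N - 2 * j) := by
  have hinv : ∀ j, ∀ f g, weightedForm L (4 * j) (f.comp (-X)) (g.comp (-X)) =
      weightedForm L (4 * j) f g := fun j =>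
    weightedForm_comp_neg_X hL (Even.mul_right (by decide) j)
  have elim : ∀ m ≤ k, ∃ a : ℕ → ℝ, ∀ i < 2 * m,
      (Q - ∑ j ∈ Finset.range m, C (a j) * X ^ (2 * j) * P j (N - 2 * j)).coeff i = 0 := by
    intro m
    induction m with
    | zero => exact fun _ => ⟨0, by simp⟩
    | succ m ih =>
      intro hm
      obtain ⟨a, ha⟩ := ih (by omega)
      have hPm := hP m (by omega)
      have hc := hPm.coeff_mod_two_ne_zero (hinv m) (weightedForm_X_mul L _) (N - 2 * m)
      have hmod : (N - 2 * m) % 2 = N % 2 := by omega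
      rw [hmod] at hc
      set f := Q - ∑ j ∈ Finset.range m, C (a j) * X ^ (2 * j) * P j (N - 2 * j) with hf
      refine ⟨Function.update a m (f.coeff (2 * m + N % 2) / (P m (N - 2 * m)).coeff (N % 2)),
        fun i hi => ?_⟩
      have hsum : ∑ j ∈ Finset.range m, C (Function.update a m
          (f.coeff (2 * m + N % 2) / (P m (N - 2 * m)).coeff (N % 2)) j) * X ^ (2 * j) *
            P j (N - 2 * j) = ∑ j ∈ Finset.range m, C (a j) * X ^ (2 * j) * P j (N - 2 * j) := by
        refine Finset.sum_congr rfl fun j hj => ?_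
        rw [Function.update_of_ne (Finset.mem_range.mp hj).ne]
      rw [Finset.sum_range_succ, hsum, ← sub_sub, ← hf, Function.update_self, coeff_sub, mul_assoc,
        coeff_C_mul, coeff_X_pow_mul']
      by_cases him : i < 2 * m
      · rw [ha i him, if_neg (by omega)]; simp
      rw [if_pos (by omega)]
      by_cases hie : i = 2 * m + N % 2
      · rw [hie, Nat.add_sub_cancel_left]
        field_simp
        simp
      have hodd : Odd (i + N) := by rw [Nat.odd_iff]; omega
      have h1 : (P m (N - 2 * m)).coeff (i - 2 * m) = 0 :=
        hPm.coeff_eq_zero_of_odd_add (hinv m) (by rw [Nat.odd_iff] at hodd ⊢; omega)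
      have h2 : f.coeff i = 0 := by
        rw [hf, coeff_sub, hpar i hodd, finsetSum_coeff, Finset.sum_eq_zero, sub_zero]
        intro j hj
        have hj := Finset.mem_range.mp hj
        rw [mul_assoc, coeff_C_mul, coeff_X_pow_mul', if_pos (by omega),
          (hP j (by omega)).coeff_eq_zero_of_odd_add (hinv j)
            (by rw [Nat.odd_iff] at hodd ⊢; omega), mul_zero]
      rw [h1, h2]; simp
  obtain ⟨a, ha⟩ := elim k le_rfl
  obtain ⟨g, hg⟩ := X_pow_dvd_iff.mpr ha
  have hgdeg : g.degree ≤ (N - 2 * k : ℕ) := by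
    rw [degree_le_iff_coeff_zero]
    intro m hm
    have hm : N - 2 * k < m := by exact_mod_cast hm
    rw [← coeff_X_pow_mul g (2 * k) m, ← hg]
    have hlt : N < m + 2 * k := by omega
    rw [coeff_sub, coeff_eq_zero_of_degree_lt (hdeg.trans_lt (by exact_mod_cast hlt)),
      finsetSum_coeff, Finset.sum_eq_zero, sub_zero]
    intro j hj
    have hj := Finset.mem_range.mp hj
    rw [mul_assoc, coeff_C_mul, coeff_X_pow_mul', if_pos (by omega),
      coeff_eq_zero_of_degree_lt, mul_zero]
    rw [(hP j hj.le).degree]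
    exact_mod_cast (by omega : N - 2 * j < m + 2 * k - 2 * j)
  obtain ⟨b, hb⟩ : ∃ b : ℝ, g = C b * P k (N - 2 * k) := by
    refine (hP k le_rfl).exists_eq_C_mul hgdeg fun h hh => ?_
    rw [weightedForm_apply,
      show (X : ℝ[X]) ^ (4 * k) * (g * h) = (X ^ (2 * k) * g) * (X ^ (2 * k) * h) by ring, ← hg,
      sub_mul, map_sub, horth h hh, Finset.sum_mul, map_sum, Finset.sum_eq_zero, sub_zero]
    intro j hj
    have hj := Finset.mem_range.mp hj
    have h1 : C (a j) * X ^ (2 * j) * P j (N - 2 * j) * (X ^ (2 * k) * h) =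
        a j • (X ^ (4 * j) * ((X ^ (2 * (k - j)) * h) * P j (N - 2 * j))) := by
      obtain ⟨d, rfl⟩ := Nat.exists_eq_add_of_lt hj
      rw [smul_eq_C_mul, show j + d + 1 - j = d + 1 by omega]
      ring
    rw [h1, map_smul, ← weightedForm_apply,
      (hP j hj.le).apply_eq_zero_of_degree_lt _ le_rfl, smul_zero]
    rw [degree_lt_iff_coeff_zero]
    intro m hm
    rw [coeff_X_pow_mul', if_pos (by omega)]
    apply coeff_eq_zero_of_degree_lt (hh.trans_le _)
    exact_mod_cast (by omega : N - 2 * k ≤ m - 2 * (k - j))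
  refine ⟨Function.update a k b, ?_⟩
  rw [Finset.sum_range_succ, Function.update_self, mul_right_comm, ← hb, mul_comm g, ← hg]
  rw [Finset.sum_congr rfl fun j hj => by
    rw [Function.update_of_ne (Finset.mem_range.mp hj).ne]]
  ring

end Elimination

section Measures

variable {μ : Measure ℝ}

/-- Integration of polynomials against `μ`, as a linear functional. -/
def polyIntegral (μ : Measure ℝ) (hint : ∀ p : ℝ[X], Integrable (fun x => p.eval x) μ) :
    ℝ[X] →ₗ[ℝ] ℝ where
  toFun p := ∫ x, p.eval x ∂μ
  map_add' p q := by
    simp only [eval_add]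
    exact integral_add (hint p) (hint q)
  map_smul' a p := by
    simp only [eval_smul, smul_eq_mul, RingHom.id_apply]
    exact integral_const_mul a _

lemma polyIntegral_apply (hint : ∀ p : ℝ[X], Integrable (fun x => p.eval x) μ) (p : ℝ[X]) :
    polyIntegral μ hint p = ∫ x, p.eval x ∂μ := rfl

lemma polyIntegral_comp_neg_X (hint : ∀ p : ℝ[X], Integrable (fun x => p.eval x) μ)
    (hsym : μ.map (fun x => -x) = μ) (p : ℝ[X]) :
    polyIntegral μ hint (p.comp (-X)) = polyIntegral μ hint p := by
  rw [polyIntegral_apply, polyIntegral_apply]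
  conv_rhs => rw [← hsym]
  rw [integral_map measurable_neg.aemeasurable p.continuous.aestronglyMeasurable]
  simp

lemma integral_muMod_zero {j : ℕ} (hj : Even j) (f : ℝ → ℝ) :
    ∫ x, f x ∂(muMod μ 0 j) = ∫ x, x ^ j * f x ∂μ := by
  rw [muMod, integral_withDensity_eq_integral_toReal_smul (by fun_prop) (by simp)]
  simp [ENNReal.toReal_ofReal, hj.pow_nonneg]

lemma IsOPS.isOrthonormalFor (hint : ∀ p : ℝ[X], Integrable (fun x => p.eval x) μ) {j : ℕ}
    (hj : Even j) {P : ℕ → ℝ[X]} (hP : IsOPS (muMod μ 0 j) P) :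
    IsOrthonormalFor (weightedForm (polyIntegral μ hint) j) P where
  symm f g := by rw [weightedForm_apply, weightedForm_apply, mul_comm f]
  degree := hP.1
  inner n m := by
    rw [← hP.2.2 n m, integral_muMod_zero hj, weightedForm_apply, polyIntegral_apply]
    simp

/-- The discrete Sobolev inner product at `0` as a bilinear form. -/
def sobForm (μ : Measure ℝ) (hint : ∀ p : ℝ[X], Integrable (fun x => p.eval x) μ) (r : ℕ)
    (M : ℕ → ℝ) : LinearMap.BilinForm ℝ ℝ[X] :=
  weightedForm (polyIntegral μ hint) 0 +
    ∑ i ∈ Finset.range (r + 1),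
      (M i * (i.factorial : ℝ) ^ 2) • (LinearMap.mul ℝ ℝ).compl₁₂ (lcoeff ℝ i) (lcoeff ℝ i)

lemma sobForm_apply (hint : ∀ p : ℝ[X], Integrable (fun x => p.eval x) μ) (r : ℕ) (M : ℕ → ℝ)
    (f g : ℝ[X]) : sobForm μ hint r M f g = polyIntegral μ hint (f * g) +
      ∑ i ∈ Finset.range (r + 1), M i * (i.factorial : ℝ) ^ 2 * (f.coeff i * g.coeff i) := by
  simp [sobForm, weightedForm_apply, LinearMap.sum_apply]

lemma sobInner_zero_eq_sobForm (hint : ∀ p : ℝ[X], Integrable (fun x => p.eval x) μ) (r : ℕ)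
    (M : ℕ → ℝ) (f g : ℝ[X]) : sobInner μ 0 r M f g = sobForm μ hint r M f g := by
  rw [sobForm_apply, sobInner, polyIntegral_apply]
  simp only [eval_mul, ← coeff_zero_eq_eval_zero, coeff_iterate_derivative, zero_add,
    Nat.descFactorial_self, nsmul_eq_mul]
  congr 1
  exact Finset.sum_congr rfl fun i _ => by ring

lemma IsSobOPS.isOrthonormalFor (hint : ∀ p : ℝ[X], Integrable (fun x => p.eval x) μ) {r : ℕ}
    {M : ℕ → ℝ} {q : ℕ → ℝ[X]} (hq : IsSobOPS μ 0 r M q) :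
    IsOrthonormalFor (sobForm μ hint r M) q where
  symm f g := by simp only [sobForm_apply, mul_comm f, mul_comm (f.coeff _)]
  degree := hq.1
  inner n m := by rw [← hq.2.2 n m, sobInner_zero_eq_sobForm hint]

lemma sobForm_comp_neg_X (hint : ∀ p : ℝ[X], Integrable (fun x => p.eval x) μ)
    (hsym : μ.map (fun x => -x) = μ) (r : ℕ) (M : ℕ → ℝ) (f g : ℝ[X]) :
    sobForm μ hint r M (f.comp (-X)) (g.comp (-X)) = sobForm μ hint r M f g := by
  rw [sobForm_apply, sobForm_apply, ← mul_comp, polyIntegral_comp_neg_X hint hsym]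
  congr 1
  refine Finset.sum_congr rfl fun i _ => ?_
  rw [IsOrthonormalFor.coeff_comp_neg_X, IsOrthonormalFor.coeff_comp_neg_X]
  rcases neg_one_pow_eq_or ℝ i with h | h <;> rw [h] <;> ring

/-- The connection formula for `q N`, of either parity. -/
lemma IsSobOPS.exists_connection_coefficients
    (hint : ∀ p : ℝ[X], Integrable (fun x => p.eval x) μ) (hsym : μ.map (fun x => -x) = μ)
    {r : ℕ} {M : ℕ → ℝ} {P : ℕ → ℕ → ℝ[X]}
    (hP : ∀ j ≤ r + 1, IsOPS (muMod μ 0 (4 * j)) (P j))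
    {q : ℕ → ℝ[X]} (hq : IsSobOPS μ 0 (2 * r + 1) M q) {N : ℕ} (hN : 2 * (r + 1) ≤ N) :
    ∃ a : ℕ → ℝ, (∃ j ≤ r + 1, a j ≠ 0) ∧
      q N = ∑ j ∈ Finset.range (r + 2), C (a j) * X ^ (2 * j) * P j (N - 2 * j) := by
  have hQ := hq.isOrthonormalFor hint
  obtain ⟨a, ha⟩ := _root_.exists_connection_coefficients (polyIntegral_comp_neg_X hint hsym) hN
    (fun j hj => (hP j hj).isOrthonormalFor hint (Even.mul_right (by decide) j))
    (hQ.degree N).le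
    (fun i hi => hQ.coeff_eq_zero_of_odd_add (sobForm_comp_neg_X hint hsym _ M) hi)
    (by
      intro h hh
      have hdeg : (X ^ (2 * (r + 1)) * h).degree < (N : WithBot ℕ) := by
        rw [degree_lt_iff_coeff_zero]
        intro m hm
        rw [coeff_X_pow_mul', if_pos (by omega)]
        apply coeff_eq_zero_of_degree_lt (hh.trans_le _)
        exact_mod_cast (by omega : N - 2 * (r + 1) ≤ m - 2 * (r + 1))
      have h1 := hQ.apply_eq_zero_of_degree_lt N le_rfl _ hdeg
      rw [sobForm_apply, Finset.sum_eq_zero, add_zero] at h1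
      · rwa [mul_comm]
      intro i hi
      have hi := Finset.mem_range.mp hi
      rw [coeff_X_pow_mul', if_neg (by omega)]
      simp)
  refine ⟨a, ?_, ha⟩
  by_contra! hz
  apply hQ.ne_zero N
  rw [ha]
  refine Finset.sum_eq_zero fun j hj => ?_
  rw [hz j (by have := Finset.mem_range.mp hj; omega)]
  simp

end Measures

/-- **Theorem 3 (symmetric case).** For a symmetric measure `μ` and the Sobolev inner
product at `c = 0` with masses `M_0, …, M_{2r+1} ≥ 0`, there exist two families of
coefficients, not identically zero, with
`q_{2n}(x) = Σ_{j=0}^{r+1} λ_{j,n} x^{2j} p_{2n-2j}^{[4j]}(x)` and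
`q_{2n+1}(x) = Σ_{j=0}^{r+1} λ*_{j,n} x^{2j} p_{2n+1-2j}^{[4j]}(x)` for `n ≥ r+1`. -/
theorem symmetric_connection_formulas
    (μ : Measure ℝ) [IsFiniteMeasure μ]
    (hsupp : (measSupport μ).Infinite)
    (hint : ∀ p : Polynomial ℝ, Integrable (fun x => p.eval x) μ)
    (hsym : μ.map (fun x => -x) = μ)
    (r : ℕ) (M : ℕ → ℝ) (hM : ∀ i ≤ 2 * r + 1, 0 ≤ M i)
    (P : ℕ → ℕ → Polynomial ℝ)
    (hP : ∀ j ≤ r + 1, IsOPS (muMod μ 0 (4 * j)) (P j))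
    (q : ℕ → Polynomial ℝ) (hq : IsSobOPS μ 0 (2 * r + 1) M q) :
    ∃ lam lamStar : ℕ → ℕ → ℝ,
      ∀ n, r + 1 ≤ n →
        (∃ j ≤ r + 1, lam n j ≠ 0) ∧ (∃ j ≤ r + 1, lamStar n j ≠ 0) ∧
        q (2 * n) = ∑ j ∈ Finset.range (r + 2),
          Polynomial.C (lam n j) * Polynomial.X ^ (2 * j) * P j (2 * n - 2 * j) ∧
        q (2 * n + 1) = ∑ j ∈ Finset.range (r + 2),
          Polynomial.C (lamStar n j) * Polynomial.X ^ (2 * j) * P j (2 * n + 1 - 2 * j) := by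
  have key : ∀ n, r + 1 ≤ n → ∀ ε : ℕ, ∃ a : ℕ → ℝ, (∃ j ≤ r + 1, a j ≠ 0) ∧
      q (2 * n + ε) = ∑ j ∈ Finset.range (r + 2),
        C (a j) * X ^ (2 * j) * P j (2 * n + ε - 2 * j) := fun n hn ε =>
    hq.exists_connection_coefficients hint hsym hP (by omega)
  choose! a ha using key
  exact ⟨fun n => a n 0, fun n => a n 1, fun n hn =>
    ⟨(ha n hn 0).1, (ha n hn 1).1, (ha n hn 0).2, (ha n hn 1).2⟩⟩
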